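/- FC(3,5) = 3: every family of 3 distinct 3-element subsets of [5] generates a Frankl-Complete family, and there exists a family of 2 distinct 3-element subsets of [5] whose generated union-closed family is Non–Frankl-Complete. -/

import Mathlib

/-- A family of sets is union-closed. -/
def UC (F : Finset (Finset ℕ)) : Prop := ∀ A ∈ F, ∀ B ∈ F, A ∪ B ∈ F

/-- `famU F` is the union `U(F)` of all members of the family `F`. -/
def famU (F : Finset (Finset ℕ)) : Finset ℕ := F.sup id

/-- `memFam F i` is the subfamily `F_i` of sets in `F` containing `i`. -/
def memFam (F : Finset (Finset ℕ)) (i : ℕ) : Finset (Finset ℕ) :=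
  F.filter (fun S => i ∈ S)

/-- `A` is Frankl-Complete: every union-closed family containing `A` has an
element of `U(A)` belonging to at least half of its sets. -/
def FC (A : Finset (Finset ℕ)) : Prop :=
  ∀ F : Finset (Finset ℕ), UC F → A ⊆ F →
    ∃ i ∈ famU A, 2 * (memFam F i).card ≥ F.card

/-- `A` is Non–Frankl-Complete: some union-closed family containing `A` has every
element of `U(A)` in fewer than half of its sets. -/
def NonFC (A : Finset (Finset ℕ)) : Prop :=
  ∃ F : Finset (Finset ℕ), UC F ∧ A ⊆ F ∧
    ∀ i ∈ famU A, 2 * (memFam F i).card < F.card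

/-- `gen S` is the union-closed family generated by `S`: the smallest
union-closed family containing `S`, given explicitly as all unions of
nonempty subfamilies of `S`. -/
def gen (S : Finset (Finset ℕ)) : Finset (Finset ℕ) :=
  (S.powerset.filter (fun T => T.Nonempty)).image (fun T => T.sup id)

/-- The set of all `e i` with `i < n` such that the `i`-th binary digit of `m` is `1`. -/
def maskSet (n : ℕ) (e : ℕ → ℕ) (m : ℕ) : Finset ℕ :=
  ((Finset.range n).filter (fun i => m.testBit i = true)).image e

lemma mem_maskSet {n : ℕ} {e : ℕ → ℕ} {m a : ℕ} :
    a ∈ maskSet n e m ↔ ∃ i < n, m.testBit i = true ∧ e i = a := by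
  simp [maskSet, and_assoc]

lemma maskSet_lor (n : ℕ) (e : ℕ → ℕ) (x y : ℕ) :
    maskSet n e (x ||| y) = maskSet n e x ∪ maskSet n e y := by
  ext a
  simp only [mem_maskSet, Finset.mem_union, Nat.testBit_or, Bool.or_eq_true]
  grind

lemma apply_mem_maskSet {n : ℕ} {e : ℕ → ℕ} (he : Set.InjOn e (Finset.range n)) {m i : ℕ}
    (hi : i < n) : e i ∈ maskSet n e m ↔ m.testBit i = true := by
  rw [mem_maskSet]
  constructor
  · rintro ⟨j, hj, hm, hji⟩
    rwa [← he (by simpa using hj) (by simpa using hi) hji]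
  · exact fun h => ⟨i, hi, h, rfl⟩

lemma maskSet_injOn {n : ℕ} {e : ℕ → ℕ} (he : Set.InjOn e (Finset.range n)) {x y : ℕ}
    (hx : x < 2 ^ n) (hy : y < 2 ^ n) (h : maskSet n e x = maskSet n e y) : x = y := by
  apply Nat.eq_of_testBit_eq
  intro i
  by_cases hi : i < n
  · rw [Bool.eq_iff_iff, ← apply_mem_maskSet he hi, ← apply_mem_maskSet he hi, h]
  · have hpow : 2 ^ n ≤ 2 ^ i := Nat.pow_le_pow_right (by norm_num) (by omega)
    rw [Nat.testBit_lt_two_pow (hx.trans_le hpow), Nat.testBit_lt_two_pow (hy.trans_le hpow)]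

lemma exists_maskSet_eq (e : ℕ → ℕ) {T : Finset ℕ} (hT : T ⊆ (Finset.range 5).image e) :
    ∃ m < 2 ^ 5, maskSet 5 e m = T := by
  have key : ∀ R ∈ (Finset.range 5).powerset, ∃ m < 2 ^ 5,
      (Finset.range 5).filter (fun i => m.testBit i = true) = R := by decide +kernel
  obtain ⟨R, hR, rfl⟩ := Finset.subset_image_iff.1 hT
  obtain ⟨m, hm, rfl⟩ := key R (by simpa using hR)
  exact ⟨m, hm, rfl⟩

/-- The weight of `i`, with positive sign when the `i`-th binary digit of `m` is `1`. -/
def signed (w : List ℤ) (m i : ℕ) : ℤ :=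
  if m.testBit i = true then w.getD i 0 else -w.getD i 0

/-- The weight of the set coded by `m` minus the weight of its complement in `range 5`. -/
def excess (w : List ℤ) (m : ℕ) : ℤ :=
  signed w m 0 + signed w m 1 + signed w m 2 + signed w m 3 + signed w m 4

lemma excess_eq_sum (w : List ℤ) (m : ℕ) : excess w m =
    ∑ i ∈ Finset.range 5, w.getD i 0 * (if m.testBit i = true then 1 else -1) := by
  simp only [excess, signed, Finset.sum_range_succ, Finset.sum_range_zero, zero_add, mul_ite,
    mul_one, mul_neg]

/-- All unions of a member of `L` with a subfamily of `G`. -/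
def absorb (G L : List ℕ) : List ℕ :=
  G.foldl (fun M g => M ++ M.map (fun m => m ||| g)) L

/-- The elements forced by adding `x` to a closed list `C`. -/
def extend (G C : List ℕ) (x : ℕ) : List ℕ :=
  (absorb G [x] ++ C.map (fun m => x ||| m)) ∪ C

/-- Branch on which of the candidates `l` of negative excess belong to a closed family containing
`C`, and test that the total excess is nonnegative in every branch. -/
def search (G : List ℕ) (w : List ℤ) : List ℕ → List ℕ → Bool
  | [], C => decide (0 ≤ (C.map (excess w)).sum)
  | x :: l, C =>
    decide (0 ≤ ((C ++ (x :: l).filter (fun m => !C.elem m)).map (excess w)).sum) ||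
      (search G w l C && (C.elem x || search G w l (extend G C x)))

/-- The codes of negative excess. -/
def negatives (w : List ℤ) : List ℕ := (List.range 32).filter (fun m => decide (excess w m < 0))

lemma sum_le_sum_of_sdiff {α : Type*} [DecidableEq α] {s t : Finset α} {f : α → ℤ}
    (hs : ∀ x ∈ s, x ∉ t → f x ≤ 0) (ht : ∀ x ∈ t, x ∉ s → 0 ≤ f x) :
    ∑ x ∈ s, f x ≤ ∑ x ∈ t, f x := by
  have h₁ : ∑ x ∈ s \ t, f x ≤ 0 := Finset.sum_nonpos (by simpa using hs)
  have h₂ : 0 ≤ ∑ x ∈ t \ s, f x := Finset.sum_nonneg (by simpa using ht)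
  have h₃ := Finset.sum_inter_add_sum_sdiff s t f
  have h₄ := Finset.sum_inter_add_sum_sdiff t s f
  rw [Finset.inter_comm] at h₄
  linarith

lemma forall_mem_absorb {p : ℕ → Prop} {G : List ℕ} (hG : ∀ x, p x → ∀ g ∈ G, p (x ||| g)) :
    ∀ L : List ℕ, (∀ x ∈ L, p x) → ∀ x ∈ absorb G L, p x := by
  induction G with
  | nil => exact fun L hL => hL
  | cons g G ih =>
    intro L hL
    refine ih (fun x hx g' hg' => hG x hx g' (List.mem_cons_of_mem _ hg')) _ ?_
    intro x hx
    rcases List.mem_append.1 hx with hx | hx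
    · exact hL x hx
    · obtain ⟨y, hy, rfl⟩ := List.mem_map.1 hx
      exact hG y (hL y hy) g List.mem_cons_self

lemma forall_mem_extend {p : ℕ → Prop} {G C : List ℕ} {x : ℕ}
    (hG : ∀ x, p x → ∀ g ∈ G, p (x ||| g)) (hp : ∀ x y, p x → p y → p (x ||| y))
    (hC : ∀ m ∈ C, p m) (hx : p x) : ∀ m ∈ extend G C x, p m := by
  intro m hm
  rcases List.mem_union_iff.1 hm with hm | hm
  · rcases List.mem_append.1 hm with hm | hm
    · exact forall_mem_absorb hG [x] (by simpa using hx) m hm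
    · obtain ⟨y, hy, rfl⟩ := List.mem_map.1 hm
      exact hp x y hx (hC y hy)
  · exact hC m hm

lemma mem_extend_self (G C : List ℕ) (x : ℕ) : x ∈ extend G C x := by
  have h : ∀ L : List ℕ, x ∈ L → x ∈ absorb G L := by
    induction G with
    | nil => exact fun L hL => hL
    | cons g G ih => exact fun L hL => ih _ (List.mem_append_left _ hL)
  exact List.mem_union_iff.2 (Or.inl (List.mem_append_left _ (h [x] (by simp))))

lemma sum_excess_nonneg_of_search {G : List ℕ} {w : List ℤ} {s : Finset ℕ}
    (hG : ∀ x ∈ s, ∀ g ∈ G, x ||| g ∈ s) (hs : ∀ x y, x ∈ s → y ∈ s → x ||| y ∈ s) :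
    ∀ l C : List ℕ, search G w l C = true → l.Nodup → C.Nodup → (∀ m ∈ C, m ∈ s) →
      (∀ m ∈ l, excess w m < 0) → (∀ m ∈ s, excess w m < 0 → m ∈ C ∨ m ∈ l) →
      0 ≤ ∑ m ∈ s, excess w m := by
  have leaf : ∀ l C : List ℕ, l.Nodup → C.Nodup → (∀ m ∈ C, m ∈ s) →
      (∀ m ∈ l, excess w m < 0) → (∀ m ∈ s, excess w m < 0 → m ∈ C ∨ m ∈ l) →
      0 ≤ ((C ++ l.filter (fun m => !C.elem m)).map (excess w)).sum →
      0 ≤ ∑ m ∈ s, excess w m := by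
    intro l C hl hC hCs hneg hcov h
    have hnodup : (C ++ l.filter (fun m => !C.elem m)).Nodup := by
      refine hC.append (hl.filter _) ?_
      intro m hm hm'
      simp [hm] at hm'
    rw [← List.sum_toFinset _ hnodup] at h
    refine h.trans (sum_le_sum_of_sdiff ?_ ?_)
    · intro m hm hms
      simp only [List.mem_toFinset, List.mem_append, List.mem_filter] at hm
      rcases hm with hm | hm
      · exact absurd (hCs m hm) hms
      · exact (hneg m hm.1).le
    · intro m hm hml
      by_contra! hlt
      apply hml
      by_cases hmC : m ∈ C
      · simp [hmC]
      · simpa [hmC] using (hcov m hm hlt).resolve_left hmC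
  intro l
  induction l with
  | nil =>
    intro C h hl hC hCs hneg hcov
    refine leaf [] C hl hC hCs hneg hcov ?_
    simpa [search] using h
  | cons x l ih =>
    intro C h hl hC hCs hneg hcov
    rw [search, Bool.or_eq_true, Bool.and_eq_true, Bool.or_eq_true, decide_eq_true_iff] at h
    rcases h with h | ⟨hout, hin⟩
    · exact leaf _ C hl hC hCs hneg hcov h
    have hl' := (List.nodup_cons.1 hl).2
    have hneg' : ∀ m ∈ l, excess w m < 0 := fun m hm => hneg m (List.mem_cons_of_mem _ hm)
    by_cases hx : x ∈ s ∧ x ∉ C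
    · refine ih _ (hin.resolve_left (by simpa using hx.2)) hl' (hC.union _)
        (forall_mem_extend hG hs hCs hx.1) hneg' ?_
      intro m hm hlt
      rcases hcov m hm hlt with h | h
      · exact Or.inl (List.mem_union_iff.2 (Or.inr h))
      · rcases List.mem_cons.1 h with rfl | h
        · exact Or.inl (mem_extend_self G C m)
        · exact Or.inr h
    · refine ih C hout hl' hC hCs hneg' ?_
      intro m hm hlt
      rcases hcov m hm hlt with h | h
      · exact Or.inl h
      · rcases List.mem_cons.1 h with rfl | h
        · exact Or.inl (by by_contra hmC; exact hx ⟨hm, hmC⟩)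
        · exact Or.inr h

/-- Total excess over a union-closed family, computed trace by trace. -/
lemma sum_excess_family_nonneg {F : Finset (Finset ℕ)} (hF : UC F) {e : ℕ → ℕ}
    (he : Set.InjOn e (Finset.range 5)) {G : List ℕ} {w : List ℤ} (hG : ∀ g ∈ G, g < 2 ^ 5)
    (hGF : ∀ g ∈ G, maskSet 5 e g ∈ F) (h : search G w (negatives w) [] = true) :
    0 ≤ ∑ A ∈ F, ∑ i ∈ Finset.range 5, w.getD i 0 * (if e i ∈ A then 1 else -1) := by
  set E := (Finset.range 5).image e with hE
  have hmE : ∀ m, maskSet 5 e m ⊆ E := fun m =>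
    Finset.image_subset_image (Finset.filter_subset _ _)
  rw [← Finset.sum_fiberwise_of_maps_to (t := F.image (· \ E)) (g := (· \ E))
    (fun A hA => Finset.mem_image_of_mem _ hA)]
  refine Finset.sum_nonneg fun K hK => ?_
  have hKE : Disjoint E K := by
    obtain ⟨A, -, rfl⟩ := Finset.mem_image.1 hK
    exact Finset.disjoint_sdiff
  set s := (Finset.range 32).filter (fun m => maskSet 5 e m ∪ K ∈ F) with hs
  have hms : ∀ m, m ∈ s ↔ m < 2 ^ 5 ∧ maskSet 5 e m ∪ K ∈ F := by simp [hs]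
  have hfib : F.filter (fun A => A \ E = K) = s.image (fun m => maskSet 5 e m ∪ K) := by
    ext A
    simp only [Finset.mem_filter, Finset.mem_image, hms]
    constructor
    · rintro ⟨hA, rfl⟩
      obtain ⟨m, hm, hmA⟩ := exists_maskSet_eq e (T := A ∩ E) Finset.inter_subset_right
      have hAm : maskSet 5 e m ∪ A \ E = A := by rw [hmA]; exact sup_inf_sdiff A E
      exact ⟨m, ⟨hm, hAm.symm ▸ hA⟩, hAm⟩
    · rintro ⟨m, ⟨hm, hmF⟩, rfl⟩
      refine ⟨hmF, ?_⟩
      rw [Finset.union_sdiff_distrib, Finset.sdiff_eq_empty_iff_subset.2 (hmE m),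
        Finset.empty_union, Finset.sdiff_eq_self_of_disjoint hKE.symm]
  rw [hfib, Finset.sum_image]
  · have hex : ∀ m ∈ s, ∑ i ∈ Finset.range 5,
        w.getD i 0 * (if e i ∈ maskSet 5 e m ∪ K then 1 else -1) = excess w m := by
      intro m _
      rw [excess_eq_sum]
      refine Finset.sum_congr rfl fun i hi => ?_
      have hiK : e i ∉ K := Finset.disjoint_left.1 hKE (Finset.mem_image_of_mem e hi)
      simp only [Finset.mem_union, hiK, or_false, apply_mem_maskSet he (Finset.mem_range.1 hi)]
    rw [Finset.sum_congr rfl hex]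
    refine sum_excess_nonneg_of_search (G := G) ?_ ?_ _ [] h (List.nodup_range.filter _)
      List.nodup_nil (by simp) (by simp [negatives]) ?_
    · intro x hx g hg
      rw [hms] at hx ⊢
      refine ⟨Nat.or_lt_two_pow hx.1 (hG g hg), ?_⟩
      rw [maskSet_lor, Finset.union_right_comm]
      exact hF _ hx.2 _ (hGF g hg)
    · intro x y hx hy
      rw [hms] at hx hy ⊢
      refine ⟨Nat.or_lt_two_pow hx.1 hy.1, ?_⟩
      rw [maskSet_lor, Finset.union_union_distrib_right]
      exact hF _ hx.2 _ hy.2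
    · intro m hm hlt
      exact Or.inr (by simpa [negatives, hlt] using ((hms m).1 hm).1)
  · intro x hx y hy hxy
    rw [Finset.mem_coe, hms] at hx hy
    refine maskSet_injOn he hx.1 hy.1 ?_
    have hd : ∀ m, (maskSet 5 e m ∪ K) \ K = maskSet 5 e m := fun m =>
      Finset.union_sdiff_cancel_right (hKE.mono_left (hmE m))
    rw [← hd x, ← hd y]
    exact congrArg (· \ K) hxy

lemma sum_ite_mem_eq (F : Finset (Finset ℕ)) (a : ℕ) :
    ∑ A ∈ F, (if a ∈ A then (1 : ℤ) else -1) = 2 * (memFam F a).card - F.card := by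
  have h := Finset.card_filter_add_card_filter_not (s := F) (fun A => a ∈ A)
  rw [Finset.sum_ite, Finset.sum_const, Finset.sum_const, memFam]
  simp only [nsmul_eq_mul]
  push_cast [← h]
  ring

lemma subset_gen (S : Finset (Finset ℕ)) : S ⊆ gen S := fun A hA =>
  Finset.mem_image.2 ⟨{A}, by simpa using hA, by simp⟩

/-- The weights `w` on five points witness that the triples coded by `G` generate a
Frankl-Complete family. -/
def Certified (G : List ℕ) (w : List ℤ) : Prop :=
  (∀ g ∈ G, g < 2 ^ 5) ∧ (∃ i < 5, 0 < w.getD i 0) ∧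
    (∀ i < 5, 0 ≤ w.getD i 0 ∧ (0 < w.getD i 0 → ∃ g ∈ G, g.testBit i = true)) ∧
    search G w (negatives w) [] = true

lemma FC_gen_of_certified {G : List ℕ} {w : List ℤ} (h : Certified G w) {e : ℕ → ℕ}
    (he : Set.InjOn e (Finset.range 5)) :
    FC (gen (G.map (maskSet 5 e)).toFinset) := by
  obtain ⟨hG, ⟨i₀, hi₀, hw₀⟩, hw, hsearch⟩ := h
  intro F hF hGF
  have hgen : ∀ g ∈ G, maskSet 5 e g ∈ gen (G.map (maskSet 5 e)).toFinset := fun g hg =>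
    subset_gen _ (List.mem_toFinset.2 (List.mem_map_of_mem hg))
  have hsum := sum_excess_family_nonneg hF he hG (fun g hg => hGF (hgen g hg)) hsearch
  by_contra! hcon
  rw [Finset.sum_comm] at hsum
  refine absurd hsum (not_le.2 ?_)
  have hlt : ∀ i < 5, 0 < w.getD i 0 → (2 * (memFam F (e i)).card - F.card : ℤ) < 0 := by
    intro i hi hwi
    obtain ⟨g, hg, hgi⟩ := (hw i hi).2 hwi
    have := hcon (e i) (Finset.mem_sup.2 ⟨_, hgen g hg, (apply_mem_maskSet he hi).2 hgi⟩)
    omega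
  refine Finset.sum_neg' ?_ ⟨i₀, Finset.mem_range.2 hi₀, ?_⟩
  · intro i hi
    rw [← Finset.mul_sum, sum_ite_mem_eq]
    have hi := Finset.mem_range.1 hi
    rcases (hw i hi).1.eq_or_lt with h0 | h0
    · rw [← h0, zero_mul]
    · exact (mul_neg_of_pos_of_neg h0 (hlt i hi h0)).le
  · rw [← Finset.mul_sum, sum_ite_mem_eq]
    exact mul_neg_of_pos_of_neg hw₀ (hlt i₀ hi₀ hw₀)

/-- The four isomorphism types of three triples in a five-element set, with weights. -/
def tripleTypes : List (List ℕ × List ℤ) :=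
  [([28, 25, 26], [2, 2, 2, 3, 3]), ([28, 26, 22], [0, 1, 1, 1, 1]),
    ([28, 25, 19], [3, 2, 2, 3, 4]), ([28, 25, 7], [3, 1, 3, 3, 3])]

instance (G : List ℕ) (w : List ℤ) : Decidable (Certified G w) := by
  unfold Certified; infer_instance

lemma certified_tripleTypes : ∀ t ∈ tripleTypes, Certified t.1 t.2 := by
  decide +kernel

lemma injOn_renaming : ∀ l ∈ List.permutations' [1, 2, 3, 4, 5],
    Set.InjOn (fun i => l.getD i 0) (Finset.range 5 : Set ℕ) := by
  have h : ∀ l ∈ List.permutations' [1, 2, 3, 4, 5], ∀ i < 5, ∀ j < 5,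
      l.getD i 0 = l.getD j 0 → i = j := by decide +kernel
  intro l hl i hi j hj
  exact h l hl i (by simpa using hi) j (by simpa using hj)

lemma exists_renaming : ∀ S ∈ ((Finset.Icc 1 5).powersetCard 3).powersetCard 3,
    ∃ l ∈ List.permutations' [1, 2, 3, 4, 5], ∃ t ∈ tripleTypes,
      S = (t.1.map (maskSet 5 (fun i => l.getD i 0))).toFinset := by
  have h : ∀ S ∈ ((Finset.Icc 1 5).powersetCard 3).powersetCard 3,
      ∃ l ∈ List.permutations' [1, 2, 3, 4, 5], ∃ t ∈ tripleTypes,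
        (∀ g ∈ t.1, maskSet 5 (fun i => l.getD i 0) g ∈ S) ∧
          3 ≤ (t.1.map (maskSet 5 (fun i => l.getD i 0))).toFinset.card := by
    decide +kernel
  intro S hS
  obtain ⟨l, hl, t, ht, hmem, hcard⟩ := h S hS
  refine ⟨l, hl, t, ht, (Finset.eq_of_subset_of_card_le ?_ ?_).symm⟩
  · intro A hA
    obtain ⟨g, hg, rfl⟩ := List.mem_map.1 (List.mem_toFinset.1 hA)
    exact hmem g hg
  · exact (Finset.mem_powersetCard.1 hS).2.trans_le hcard

/-- A union-closed family on `26` points, as pairs of a trace on the upper `22` points and the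
closed family on the lower four points attached to it. The full trace carries the full cube. -/
def sparseBlocks : List (ℕ × List ℕ) :=
  (0, [7, 11, 15]) :: ((List.range 22).reverse.map (fun j => (67108848 - 2 ^ (j + 4),
    if j < 3 then [0, 1, 2, 3, 4, 5, 6, 7, 11, 15]
    else if j < 6 then [0, 1, 2, 3, 7, 8, 9, 10, 11, 15]
    else if j < 14 then [0, 1, 4, 5, 7, 8, 9, 11, 12, 13, 15]
    else [0, 2, 4, 6, 7, 8, 10, 11, 12, 14, 15])) ++ [(67108848, List.range 16)])

/-- Codes of the members of the family described by `sparseBlocks`. -/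
def sparseCodes : List ℕ := sparseBlocks.flatMap (fun b => b.2.map (fun x => b.1 ||| x))

lemma mem_sparseCodes {n : ℕ} :
    n ∈ sparseCodes ↔ ∃ b ∈ sparseBlocks, ∃ x ∈ b.2, b.1 ||| x = n := by
  simp [sparseCodes]

lemma sparseBlocks_lor : ∀ b ∈ sparseBlocks, ∀ c ∈ sparseBlocks,
    b.1 ||| c.1 = 67108848 ∨
      ∃ d ∈ sparseBlocks, b.1 ||| c.1 = d.1 ∧ ∀ x ∈ b.2, ∀ y ∈ c.2, x ||| y ∈ d.2 := by
  decide +kernel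

lemma sparseBlocks_lt : ∀ b ∈ sparseBlocks, b.1 < 2 ^ 26 ∧ ∀ x ∈ b.2, x < 2 ^ 4 := by
  decide +kernel

lemma full_mem_sparseBlocks : (67108848, List.range 16) ∈ sparseBlocks := by
  decide +kernel

lemma sparseCodes_lor {m n : ℕ} (hm : m ∈ sparseCodes) (hn : n ∈ sparseCodes) :
    m ||| n ∈ sparseCodes := by
  obtain ⟨b, hb, x, hx, rfl⟩ := mem_sparseCodes.1 hm
  obtain ⟨c, hc, y, hy, rfl⟩ := mem_sparseCodes.1 hn
  have hlor : b.1 ||| x ||| (c.1 ||| y) = b.1 ||| c.1 ||| (x ||| y) := by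
    rw [Nat.or_assoc, Nat.or_assoc, Nat.or_left_comm x]
  rw [hlor, mem_sparseCodes]
  rcases sparseBlocks_lor b hb c hc with h | ⟨d, hd, h, hxy⟩
  · refine ⟨_, full_mem_sparseBlocks, x ||| y, List.mem_range.2 ?_, by rw [h]⟩
    exact Nat.or_lt_two_pow ((sparseBlocks_lt b hb).2 x hx) ((sparseBlocks_lt c hc).2 y hy)
  · exact ⟨d, hd, x ||| y, hxy x hx y hy, by rw [h]⟩

lemma sparseCodes_lt {n : ℕ} (hn : n ∈ sparseCodes) : n < 2 ^ 26 := by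
  obtain ⟨b, hb, x, hx, rfl⟩ := mem_sparseCodes.1 hn
  exact Nat.or_lt_two_pow (sparseBlocks_lt b hb).1
    (((sparseBlocks_lt b hb).2 x hx).trans (by norm_num))

lemma sparseCodes_nodup : sparseCodes.Nodup := by
  have h : sparseCodes.IsChain (· < ·) := by decide +kernel
  exact (List.isChain_iff_pairwise.1 h).imp ne_of_lt

lemma sparseCodes_count : ∀ i < 4,
    2 * (sparseCodes.filter (fun x => x.testBit i)).length < sparseCodes.length := by
  decide +kernel

lemma NonFC_gen_pair : NonFC (gen {{1, 2, 3}, {1, 2, 4}}) := by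
  have he : Set.InjOn (· + 1) (Finset.range 26 : Set ℕ) := (add_left_injective 1).injOn
  have hinj : Set.InjOn (maskSet 26 (· + 1)) (sparseCodes.toFinset : Set ℕ) := by
    intro x hx y hy hxy
    exact maskSet_injOn he (sparseCodes_lt (by simpa using hx))
      (sparseCodes_lt (by simpa using hy)) hxy
  have hgen : gen {{1, 2, 3}, {1, 2, 4}} = ([7, 11, 15].map (maskSet 26 (· + 1))).toFinset := by
    decide +kernel
  have hU : famU (gen {{1, 2, 3}, {1, 2, 4}}) = (Finset.range 4).image (· + 1) := by
    decide +kernel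
  refine ⟨sparseCodes.toFinset.image (maskSet 26 (· + 1)), ?_, ?_, ?_⟩
  · simp only [UC, Finset.forall_mem_image, List.mem_toFinset, ← maskSet_lor]
    exact fun x hx y hy =>
      Finset.mem_image_of_mem _ (List.mem_toFinset.2 (sparseCodes_lor hx hy))
  · rw [hgen]
    intro A hA
    obtain ⟨m, hm, rfl⟩ := List.mem_map.1 (List.mem_toFinset.1 hA)
    refine Finset.mem_image_of_mem _ (List.mem_toFinset.2 (List.mem_append_left _ ?_))
    simpa using hm
  · rw [hU, Finset.forall_mem_image]
    intro i hi
    have hi := Finset.mem_range.1 hi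
    have hmem : memFam (sparseCodes.toFinset.image (maskSet 26 (· + 1))) (i + 1) =
        (sparseCodes.filter (fun x => x.testBit i)).toFinset.image (maskSet 26 (· + 1)) := by
      rw [memFam, Finset.filter_image, List.toFinset_filter]
      refine congrArg _ (Finset.filter_congr fun x _ => ?_)
      exact apply_mem_maskSet he (by omega)
    rw [hmem, Finset.card_image_of_injOn hinj, Finset.card_image_of_injOn (hinj.mono ?_),
      List.toFinset_card_of_nodup sparseCodes_nodup,
      List.toFinset_card_of_nodup (sparseCodes_nodup.filter _)]
    · exact sparseCodes_count i hi
    · intro x hx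
      simp only [List.coe_toFinset, List.mem_filter, Set.mem_ofPred_eq] at hx ⊢
      exact hx.1

/-- FC(3,5) = 3. -/
theorem FC_3_5 :
    (∀ S : Finset (Finset ℕ), S ⊆ (Finset.Icc 1 5).powersetCard 3 → S.card = 3 →
      FC (gen S)) ∧
    (∃ S : Finset (Finset ℕ), S ⊆ (Finset.Icc 1 5).powersetCard 3 ∧ S.card = 2 ∧
      NonFC (gen S)) := by
  refine ⟨fun S hS hcard => ?_, {{1, 2, 3}, {1, 2, 4}}, by decide, by decide, NonFC_gen_pair⟩
  obtain ⟨l, hl, t, ht, rfl⟩ := exists_renaming S (Finset.mem_powersetCard.2 ⟨hS, hcard⟩)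
  exact FC_gen_of_certified (certified_tripleTypes t ht) (injOn_renaming l hl)
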